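/- arXiv:2510.03949 — 10 statements merged into one kernel-verified Lean document; each statement's English description precedes it below -/
import Mathlib

section
/- Fix 0 < β and h_LMC ∈ (0, 1/(2β)). Then there exists γ₀ > 0 such that for every γ ≥ γ₀, the parameter choice h = h_LMC·γ and η = 1 satisfies Assumption B, i.e. 2h/(γ(1−exp(−hγ))) + 6/γ² < 1/β; moreover, for this choice the contraction coefficient hηα/γ equals h_LMC·α for every γ and every α > 0. -/
open Real
open Filter Topology

/-- Overdamped limit: Assumption B is satisfiable under time acceleration.
For `0 < β` and `h_LMC ∈ (0, 1/(2β))`, there exists `γ₀ > 0` such that for all `γ ≥ γ₀`,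
the choice `h = h_LMC·γ`, `η = 1` satisfies Assumption B, i.e.
`2h/(γ(1−exp(−hγ))) + 6/γ² < 1/β`; moreover the contraction coefficient `hηα/γ`
equals `h_LMC·α` for every `γ > 0` and `α > 0`. -/
theorem klmc_overdamped_limit_assumptionB (β hLMC : ℝ) (hβ : 0 < β)
    (h1 : 0 < hLMC) (h2 : hLMC < 1 / (2 * β)) :
    (∃ γ₀ : ℝ, 0 < γ₀ ∧ ∀ γ : ℝ, γ₀ ≤ γ →
      (1 : ℝ) * (2 * (hLMC * γ) / (γ * (1 - Real.exp (-((hLMC * γ) * γ)))) + 6 / γ ^ 2)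
        < 1 / β) ∧
    (∀ γ α : ℝ, 0 < γ → 0 < α → (hLMC * γ) * 1 * α / γ = hLMC * α) := by
  refine ⟨?_, fun γ α hγ _ => by field_simp⟩
  have hlim : Tendsto (fun γ : ℝ => 2 * hLMC / (1 - Real.exp (-((hLMC * γ) * γ))) + 6 / γ ^ 2)
      atTop (𝓝 (2 * hLMC / (1 - 0) + 0)) := by
    have hexp : Tendsto (fun γ : ℝ => Real.exp (-((hLMC * γ) * γ))) atTop (𝓝 0) :=
      Real.tendsto_exp_neg_atTop_nhds_zero.comp
        ((tendsto_id.const_mul_atTop h1).atTop_mul_atTop₀ tendsto_id)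
    exact (tendsto_const_nhds.div (tendsto_const_nhds.sub hexp) (by norm_num)).add
      (tendsto_const_nhds.div_atTop (tendsto_pow_atTop two_ne_zero))
  have hlt : 2 * hLMC / (1 - 0) + 0 < 1 / β := by
    rw [lt_div_iff₀ (by positivity)] at h2 ⊢
    linarith
  obtain ⟨γ₀, hγ₀⟩ := eventually_atTop.mp (hlim.eventually_lt_const hlt)
  refine ⟨max γ₀ 1, by positivity, fun γ hγ => ?_⟩
  have hγ_pos : 0 < γ := zero_lt_one.trans_le ((le_max_right _ _).trans hγ)
  have hcancel : 2 * (hLMC * γ) / (γ * (1 - Real.exp (-((hLMC * γ) * γ)))) =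
      2 * hLMC / (1 - Real.exp (-((hLMC * γ) * γ))) := by
    rw [← mul_assoc, mul_comm _ γ, mul_div_mul_left _ _ hγ_pos.ne']
  rw [one_mul, hcancel]
  exact hγ₀ γ ((le_max_left _ _).trans hγ)
end

section
/- For every ζ > 0, γ > 0, r > 0, and every c ≤ c⁻(r, ζ), one has χ_{AC−B²}(r, ζ, γ, c) ≥ 0, where c⁻(r, ζ) = p1(r) − sqrt(p2(r)·p3(r)) is the smaller real root of the convex quadratic c ↦ χ_{AC−B²}(r, ζ, γ, c). -/
noncomputable section

open Real

/-- `δ = exp(−ζ)`. -/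
def dlt (ζ : ℝ) : ℝ := Real.exp (-ζ)

def a1 (ζ : ℝ) : ℝ := (2/3) * ζ ^ 2 + 2 * (1 - dlt ζ) ^ 2
def b1 (ζ : ℝ) : ℝ := ζ - (dlt ζ - (dlt ζ) ^ 2)
def e1 (ζ : ℝ) : ℝ := (1/2) * (1 - (dlt ζ) ^ 2)
def b2 (ζ : ℝ) : ℝ := -ζ * (1 + dlt ζ) + (1 - (dlt ζ) ^ 2)
def e2 (ζ : ℝ) : ℝ := (1/2) * (1 + dlt ζ) ^ 2
def b3 (ζ : ℝ) : ℝ := -ζ * (1 - dlt ζ) - (1 - dlt ζ) ^ 2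
def e3 (ζ : ℝ) : ℝ := (1/2) * (1 - dlt ζ) ^ 2

def p1 (ζ r : ℝ) : ℝ := -a1 ζ * r ^ 2 + b1 ζ * r + e1 ζ
def p2 (ζ r : ℝ) : ℝ := a1 ζ * r ^ 2 + b2 ζ * r + e2 ζ
def p3 (ζ r : ℝ) : ℝ := a1 ζ * r ^ 2 + b3 ζ * r + e3 ζ

/-- `c⁻(r, ζ) = p1(r) − sqrt(p2(r)·p3(r))`. -/
def cminus (r ζ : ℝ) : ℝ := p1 ζ r - Real.sqrt (p2 ζ r * p3 ζ r)

/-- `χ_{AC−B²}(r, ζ, γ, c)`. -/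
def chiACB (r ζ γ c : ℝ) : ℝ :=
  (1 / γ ^ 2) *
    ((12 * c * (1 - dlt ζ) ^ 2 - 4 * ζ ^ 2 * (1 - c) + 3 * ζ ^ 2 * (dlt ζ) ^ 2
        - 6 * ζ * (dlt ζ - (dlt ζ) ^ 2) - 9 * (1 - dlt ζ) ^ 2) * r ^ 2
      + 6 * (c * (dlt ζ - (dlt ζ) ^ 2) + ζ * (1 - c) - ζ * (dlt ζ) ^ 2) * r
      + 3 * c ^ 2 - 3 * c * (1 - (dlt ζ) ^ 2))

/-- Lemma: nonnegativity of `χ_{AC−B²}` left of its smaller root: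
for all `ζ, γ, r > 0` and all `c ≤ c⁻(r, ζ)`, one has `χ_{AC−B²}(r, ζ, γ, c) ≥ 0`. -/
theorem chiACB_nonneg_of_le_cminus (ζ γ r c : ℝ)
    (hζ : 0 < ζ) (hγ : 0 < γ) (hr : 0 < r) (hc : c ≤ cminus r ζ) :
    0 ≤ chiACB r ζ γ c := by
  have hfactor : chiACB r ζ γ c =
      1 / γ ^ 2 * (3 * ((p1 ζ r - c) ^ 2 - p2 ζ r * p3 ζ r)) := by
    unfold chiACB p1 p2 p3 a1 b1 e1 b2 e2 b3 e3
    ring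
  have hsqrt : Real.sqrt (p2 ζ r * p3 ζ r) ≤ p1 ζ r - c := by
    unfold cminus at hc
    linarith
  have hsq : p2 ζ r * p3 ζ r ≤ (p1 ζ r - c) ^ 2 := (Real.sqrt_le_iff.mp hsqrt).2
  rw [hfactor]
  exact mul_nonneg (by positivity) (by linarith)
end
end

section
/- For every ζ > 0 and every r ∈ (0, r_max(ζ)), one has c⁻(r, ζ) > 0, where r_max(ζ) = 2ζ(1−δ²) / ( (4/3 − δ²)ζ² + 2δ(1−δ)ζ + 3(1−δ)² ). -/
noncomputable section

open Real

/-- `r_max(ζ) = 2ζ(1−δ²) / ((4/3 − δ²)ζ² + 2δ(1−δ)ζ + 3(1−δ)²)`. -/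
def rmax (ζ : ℝ) : ℝ :=
  2 * ζ * (1 - (dlt ζ) ^ 2) /
    ((4/3 - (dlt ζ) ^ 2) * ζ ^ 2 + 2 * dlt ζ * (1 - dlt ζ) * ζ + 3 * (1 - dlt ζ) ^ 2)

theorem dlt_pos (ζ : ℝ) : 0 < dlt ζ := Real.exp_pos _

theorem dlt_lt_one {ζ : ℝ} (hζ : 0 < ζ) : dlt ζ < 1 :=
  Real.exp_lt_one_iff.2 (neg_neg_of_pos hζ)

theorem one_add_mul_dlt_le_one (ζ : ℝ) : (1 + ζ) * dlt ζ ≤ 1 := by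
  have h : Real.exp ζ * dlt ζ = 1 := by rw [dlt, ← Real.exp_add, add_neg_cancel, Real.exp_zero]
  have h' := mul_le_mul_of_nonneg_right (Real.add_one_le_exp ζ) (dlt_pos ζ).le
  linarith

theorem p1_sq_sub_p2_mul_p3 (ζ r : ℝ) :
    p1 ζ r ^ 2 - p2 ζ r * p3 ζ r =
      r * (2 * ζ * (1 - dlt ζ ^ 2) -
        r * ((4/3 - dlt ζ ^ 2) * ζ ^ 2 + 2 * dlt ζ * (1 - dlt ζ) * ζ + 3 * (1 - dlt ζ) ^ 2)) := by
  simp only [p1, p2, p3, a1, b1, b2, b3, e1, e2, e3]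
  ring

theorem p1_add_p2 (ζ r : ℝ) :
    p1 ζ r + p2 ζ r = (1 - (1 + ζ) * dlt ζ) * r + (1 + dlt ζ) := by
  simp only [p1, p2, a1, b1, b2, e1, e2]
  ring

theorem a1_pos {ζ : ℝ} (hζ : 0 < ζ) : 0 < a1 ζ := by
  unfold a1
  positivity

/-- `p3` has nonpositive discriminant. -/
theorem p3_nonneg {ζ : ℝ} (hζ : 0 < ζ) (r : ℝ) : 0 ≤ p3 ζ r := by
  have h : 4 * a1 ζ * p3 ζ r =
      (2 * a1 ζ * r + b3 ζ) ^ 2 + (1 - dlt ζ) ^ 2 * (ζ - 3 * (1 - dlt ζ)) ^ 2 / 3 := by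
    simp only [p3, a1, b3, e3]
    ring
  refine nonneg_of_mul_nonneg_right (a := 4 * a1 ζ) ?_ (by linarith [a1_pos hζ])
  rw [h]
  positivity

theorem p2_mul_p3_lt_p1_sq {ζ r : ℝ} (hζ : 0 < ζ) (hr : 0 < r) (hrmax : r < rmax ζ) :
    p2 ζ r * p3 ζ r < p1 ζ r ^ 2 := by
  have h0 := dlt_pos ζ
  have h1 : 0 < 1 - dlt ζ := sub_pos.2 (dlt_lt_one hζ)
  have h2 : 0 < 4 / 3 - dlt ζ ^ 2 := by nlinarith
  have hD : 0 < (4/3 - dlt ζ ^ 2) * ζ ^ 2 + 2 * dlt ζ * (1 - dlt ζ) * ζ +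
      3 * (1 - dlt ζ) ^ 2 := by positivity
  have h := (lt_div_iff₀ hD).1 hrmax
  rw [← sub_pos, p1_sq_sub_p2_mul_p3]
  exact mul_pos hr (sub_pos.2 h)

theorem p1_ne_zero_of_lt_rmax {ζ r : ℝ} (hζ : 0 < ζ) (hr : 0 < r) (hrmax : r < rmax ζ) :
    p1 ζ r ≠ 0 := by
  intro h
  have hlt := p2_mul_p3_lt_p1_sq hζ hr hrmax
  have hadd := p1_add_p2 ζ r
  have hp2 : 0 ≤ p2 ζ r := by
    have := mul_nonneg (sub_nonneg.2 (one_add_mul_dlt_le_one ζ)) hr.le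
    linarith [dlt_pos ζ]
  have := mul_nonneg hp2 (p3_nonneg hζ r)
  rw [h] at hlt
  linarith

theorem p1_pos_of_lt_rmax {ζ r : ℝ} (hζ : 0 < ζ) (hr : 0 < r) (hrmax : r < rmax ζ) :
    0 < p1 ζ r := by
  by_contra! hneg
  have h0 : 0 < p1 ζ 0 := by
    simp only [p1, e1]
    nlinarith [dlt_pos ζ, dlt_lt_one hζ]
  have hcont : Continuous (p1 ζ) := by
    unfold p1
    fun_prop
  obtain ⟨s, ⟨hs0, hsr⟩, hs⟩ := intermediate_value_Icc' hr.le hcont.continuousOn ⟨hneg, h0.le⟩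
  have hs_pos : 0 < s := hs0.lt_of_ne (by rintro rfl; exact h0.ne' hs)
  exact p1_ne_zero_of_lt_rmax hζ hs_pos (hsr.trans_lt hrmax) hs

/-- Lemma: positivity of `c⁻` on `(0, r_max)`:
for every `ζ > 0` and every `r ∈ (0, r_max(ζ))`, one has `c⁻(r, ζ) > 0`. -/
theorem cminus_pos_of_lt_rmax (ζ r : ℝ) (hζ : 0 < ζ) (hr : 0 < r) (hrmax : r < rmax ζ) :
    0 < cminus r ζ := by
  exact sub_pos.2 ((Real.sqrt_lt' (p1_pos_of_lt_rmax hζ hr hrmax)).2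
    (p2_mul_p3_lt_p1_sq hζ hr hrmax))
end
end

section
/- For every ζ > 0 and every r ∈ ℝ, ( p1(r) − p4(r) )² ≤ p2(r)·p3(r), where p4(r) = (−ζ² − 3(1−δ)²)·r² + 2ζ·r. -/
noncomputable section

open Real

/-- `p4(r) = (−ζ² − 3(1−δ)²)·r² + 2ζ·r`. -/
def p4 (ζ r : ℝ) : ℝ := (-ζ ^ 2 - 3 * (1 - dlt ζ) ^ 2) * r ^ 2 + 2 * ζ * r

/-- The gap in `p1_sub_p4_sq_le` is three times a perfect square. -/
theorem p2_mul_p3_sub_sq (ζ r : ℝ) :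
    p2 ζ r * p3 ζ r - (p1 ζ r - p4 ζ r) ^ 2 =
      3 * (r * ((ζ ^ 2 / 3 + (1 - dlt ζ) ^ 2) * r - (ζ - 3 * dlt ζ * (1 - dlt ζ)) / 3)) ^ 2 := by
  unfold p1 p2 p3 p4 a1 b1 b2 b3 e1 e2 e3
  ring

/-- Lemma: key quadratic inequality: for every `ζ > 0` and every `r ∈ ℝ`,
`(p1(r) − p4(r))² ≤ p2(r)·p3(r)`. -/
theorem p1_sub_p4_sq_le (ζ r : ℝ) (hζ : 0 < ζ) :
    (p1 ζ r - p4 ζ r) ^ 2 ≤ p2 ζ r * p3 ζ r := by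
  rw [← sub_nonneg, p2_mul_p3_sub_sq]
  positivity
end
end

section
/- For every ζ > 0 and every r ∈ (0, r_lin(ζ)], one has p1(r) ≥ ζ·r, where r_lin(ζ) = ζ(1−δ) / (2ζ² + 6(1−δ)²). -/
noncomputable section

open Real

/-- `r_lin(ζ) = ζ(1−δ) / (2ζ² + 6(1−δ)²)`. -/
def rlin (ζ : ℝ) : ℝ := ζ * (1 - dlt ζ) / (2 * ζ ^ 2 + 6 * (1 - dlt ζ) ^ 2)

/-- (Lemma: `p1` dominates the linear function `ζ·r` on `(0, r_lin]`):
for every `ζ > 0` and every `r ∈ (0, r_lin(ζ)]`, one has `p1(r) ≥ ζ·r`. -/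
theorem p1_ge_linear (ζ r : ℝ) (hζ : 0 < ζ) (hr : 0 < r) (hrlin : r ≤ rlin ζ) :
    ζ * r ≤ p1 ζ r := by
  have hδ : 0 < dlt ζ := Real.exp_pos _
  have hδ' : dlt ζ < 1 := by simpa [dlt] using hζ
  unfold rlin at hrlin
  unfold p1 a1 b1 e1
  generalize dlt ζ = δ at *
  have hu : 0 < 1 - δ := by linarith
  have hζu : 0 < ζ * (1 - δ) := mul_pos hζ hu
  rw [le_div_iff₀ (by positivity)] at hrlin
  have hr6 : r ≤ 1 / 6 := by
    have hD : 6 * (ζ * (1 - δ)) ≤ 2 * ζ ^ 2 + 6 * (1 - δ) ^ 2 := by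
      nlinarith [sq_nonneg (ζ - 2 * (1 - δ)), sq_nonneg (ζ - (1 - δ))]
    have h := (mul_le_mul_of_nonneg_left hD hr.le).trans hrlin
    by_contra! hlt
    nlinarith
  have hζr : ζ * r ≤ (1 - δ) / 2 := by
    have h : ζ * (2 * (ζ * r)) ≤ ζ * (1 - δ) := by
      nlinarith [mul_nonneg hr.le (sq_nonneg (1 - δ))]
    linarith [le_of_mul_le_mul_left h hζ]
  have hδr : δ * r ≤ 1 / 6 := by nlinarith
  have hquad := mul_le_mul_of_nonneg_right hrlin hr.le
  have hsum : 0 ≤ (1 - δ) * ((1 + δ) / 2 - ζ * r / 3 - δ * r) :=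
    mul_nonneg hu.le (by linarith)
  linarith
end
end

section
/- For every ζ > 0 and every r ∈ (0, r_lin(ζ)], one has p6(r) ≥ 0, where p6(r) = a6·r² − b6·r + e6 with a6 = (4/3)ζ³ + 4ζ(1−δ)², b6 = 3(1−δ)² + ζ²(7/3 − δ²), e6 = ζ(1−δ²), and r_lin(ζ) = ζ(1−δ) / (2ζ² + 6(1−δ)²). -/
noncomputable section

open Real

/-- `p6(r) = a6·r² − b6·r + e6` with `a6 = (4/3)ζ³ + 4ζ(1−δ)²`,
`b6 = 3(1−δ)² + ζ²(7/3 − δ²)`, `e6 = ζ(1−δ²)`. -/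
def p6 (ζ r : ℝ) : ℝ :=
  ((4/3) * ζ ^ 3 + 4 * ζ * (1 - dlt ζ) ^ 2) * r ^ 2
    - (3 * (1 - dlt ζ) ^ 2 + ζ ^ 2 * (7/3 - (dlt ζ) ^ 2)) * r
    + ζ * (1 - (dlt ζ) ^ 2)

/-- (Lemma: nonnegativity of `p6` on `(0, r_lin]`):
for every `ζ > 0` and every `r ∈ (0, r_lin(ζ)]`, one has `p6(r) ≥ 0`. -/
theorem p6_nonneg (ζ r : ℝ) (hζ : 0 < ζ) (hr : 0 < r) (hrlin : r ≤ rlin ζ) :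
    0 ≤ p6 ζ r := by
  have hδ0 : 0 < dlt ζ := Real.exp_pos _
  have hδ1 : dlt ζ < 1 := Real.exp_lt_one_iff.2 (by linarith)
  unfold p6
  unfold rlin at hrlin
  generalize dlt ζ = δ at *
  have hD : 0 < 2 * ζ ^ 2 + 6 * (1 - δ) ^ 2 := by positivity
  set D := 2 * ζ ^ 2 + 6 * (1 - δ) ^ 2 with hD_def
  set s := ζ * (1 - δ) / D with hs_def
  have hsD : s * D = ζ * (1 - δ) := div_mul_cancel₀ _ hD.ne'
  have hs : 0 < s := lt_of_lt_of_le hr hrlin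
  have ha : (4/3) * ζ ^ 3 + 4 * ζ * (1 - δ) ^ 2 = (2/3) * ζ * D := by rw [hD_def]; ring
  rw [ha]
  set b := 3 * (1 - δ) ^ 2 + ζ ^ 2 * (7/3 - δ ^ 2) with hb_def
  -- `s` lies to the left of the vertex of the quadratic
  have hvertex : (2/3) * ζ * D * (r + s) ≤ b := by
    have h1 : (2/3) * ζ * D * (r + s) ≤ (2/3) * ζ * D * (2 * s) := by gcongr; linarith
    have h2 : (2/3) * ζ * D * (2 * s) = (4/3) * ζ ^ 2 * (1 - δ) := by
      linear_combination (4/3) * ζ * hsD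
    have h3 : 0 ≤ ζ ^ 2 * (1 + (4/3) * δ - δ ^ 2) := mul_nonneg (sq_nonneg ζ) (by nlinarith)
    nlinarith [sq_nonneg (1 - δ)]
  have hmono : 0 ≤ (s - r) * (b - (2/3) * ζ * D * (r + s)) :=
    mul_nonneg (sub_nonneg.2 hrlin) (sub_nonneg.2 hvertex)
  -- the value of the quadratic at `s`
  have hend : (2/3) * ζ * D * s ^ 2 - b * s + ζ * (1 - δ ^ 2)
      = s * (ζ ^ 2 * (1/3 + (4/3) * δ + δ ^ 2) + (1 - δ) ^ 2 * (3 + 6 * δ)) := by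
    rw [hb_def]
    linear_combination ((2/3) * ζ * s - (1 + δ)) * hsD + (1 + δ) * s * hD_def
  have hpos : 0 ≤ s * (ζ ^ 2 * (1/3 + (4/3) * δ + δ ^ 2) + (1 - δ) ^ 2 * (3 + 6 * δ)) := by
    positivity
  linear_combination hmono + hpos - hend
end
end

section
/- For every ζ > 0 and every r ∈ (0, r_lin(ζ)], one has c⁻(r, ζ) = p1(r) − sqrt(p2(r)·p3(r)) ≥ ζ·r, where r_lin(ζ) = ζ(1−δ) / (2ζ² + 6(1−δ)²). -/
noncomputable section

open Real

/-- `ζr ≤ p₁(r)` on `(0, r_lin]`. -/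
theorem mul_le_p1_of_le_rlin {z d r : ℝ} (hz : 0 < z) (hd0 : 0 < d) (hd1 : d < 1) (hr : 0 < r)
    (h : r * (2 * z ^ 2 + 6 * (1 - d) ^ 2) ≤ z * (1 - d)) :
    z * r ≤ -((2/3) * z ^ 2 + 2 * (1 - d) ^ 2) * r ^ 2 + (z - (d - d ^ 2)) * r
      + (1/2) * (1 - d ^ 2) := by
  have hu : 0 < 1 - d := sub_pos.2 hd1
  have hrz : r * z ≤ (1 - d) / 2 := by
    have : z * (r * z) ≤ z * ((1 - d) / 2) := by
      nlinarith [mul_nonneg hr.le (sq_nonneg (1 - d))]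
    exact le_of_mul_le_mul_left this hz
  have hr2 : r ≤ 1 / 2 := by
    have hzu : 0 < z * (1 - d) := mul_pos hz hu
    have : (z * (1 - d)) * r ≤ (z * (1 - d)) * (1 / 2) := by
      nlinarith [mul_nonneg hr.le (sq_nonneg (z - (1 - d))),
        mul_nonneg hr.le (sq_nonneg (1 - d)), mul_pos hr hzu]
    exact le_of_mul_le_mul_left this hzu
  have hsum : r * z / 3 + d * r ≤ (1 + d) / 2 := by nlinarith
  nlinarith [mul_le_mul_of_nonneg_left h hr.le, mul_le_mul_of_nonneg_left hsum hu.le]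

/-- The quadratic `((p₁(r) - ζr)² - p₂(r)p₃(r)) / r` is nonnegative on `(0, r_lin]`: it decreases
there and is nonnegative at the right endpoint. -/
theorem discriminant_quadratic_nonneg {z d r : ℝ} (hz : 0 < z) (hd0 : 0 < d) (hd1 : d < 1)
    (h : r ≤ z * (1 - d) / (2 * z ^ 2 + 6 * (1 - d) ^ 2)) :
    0 ≤ 2 * ((2/3) * z ^ 2 + 2 * (1 - d) ^ 2) * z * r ^ 2
      - (2 * ((2/3) * z ^ 2 + 2 * (1 - d) ^ 2) + (1 - d ^ 2) * z ^ 2 - (1 - d) ^ 2) * r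
      + (1 - d ^ 2) * z := by
  have hu : 0 < 1 - d := sub_pos.2 hd1
  have hz2 : 0 < z ^ 2 := by positivity
  set A := 2 * z ^ 2 + 6 * (1 - d) ^ 2 with hA
  have hA0 : 0 < A := by positivity
  set R := z * (1 - d) / A with hR
  have hRA : A * R = z * (1 - d) := by rw [hR]; field_simp
  have hR0 : 0 < R := by positivity
  set K := (2/3) * A + (1 - d ^ 2) * z ^ 2 - (1 - d) ^ 2 with hK
  have hend : 0 ≤ (2/3) * A * z * R ^ 2 - K * R + (1 - d ^ 2) * z := by
    have hfactor : (2/3) * A * z * R ^ 2 - K * R + (1 - d ^ 2) * z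
        = R * ((2/3) * z ^ 2 * (1 - d) - K + A * (1 + d)) := by
      linear_combination ((2/3) * z * R - (1 + d)) * hRA
    rw [hfactor]
    refine mul_nonneg hR0.le ?_
    rw [hK, hA]
    nlinarith [mul_pos hz2 hd0, mul_pos (mul_pos hz2 hd0) hd0, sq_nonneg (1 - d),
      mul_nonneg hd0.le (sq_nonneg (1 - d))]
  have hslope : (2/3) * A * z * (r + R) ≤ K := by
    have hle : (2/3) * A * z * (r + R) ≤ (4/3) * z ^ 2 * (1 - d) := by
      have : A * z * (r + R) ≤ A * z * (R + R) := by gcongr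
      have hz' : A * z * R = z ^ 2 * (1 - d) := by linear_combination z * hRA
      linarith
    refine hle.trans ?_
    rw [hK, hA]
    have hdd : 0 < 1 - d ^ 2 := by nlinarith
    nlinarith [mul_pos hz2 hd0, mul_pos hz2 hdd, sq_nonneg (1 - d)]
  have hdec : 0 ≤ (R - r) * (K - (2/3) * A * z * (r + R)) :=
    mul_nonneg (sub_nonneg.2 h) (sub_nonneg.2 hslope)
  have hquad : 0 ≤ (2/3) * A * z * r ^ 2 - K * r + (1 - d ^ 2) * z := by linarith
  rw [hK, hA] at hquad
  linarith

/-- Linear lower bound on the exact contraction coefficient: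
for every `ζ > 0` and every `r ∈ (0, r_lin(ζ)]`,
`c⁻(r, ζ) = p1(r) − sqrt(p2(r)·p3(r)) ≥ ζ·r`. -/
theorem cminus_ge_linear (ζ r : ℝ) (hζ : 0 < ζ) (hr : 0 < r) (hrlin : r ≤ rlin ζ) :
    ζ * r ≤ cminus r ζ := by
  have hd0 : 0 < dlt ζ := Real.exp_pos _
  have hd1 : dlt ζ < 1 := Real.exp_lt_one_iff.2 (neg_lt_zero.2 hζ)
  unfold rlin at hrlin
  have hquad := discriminant_quadratic_nonneg hζ hd0 hd1 hrlin
  have hp1 := mul_le_p1_of_le_rlin hζ hd0 hd1 hr ((le_div_iff₀ (by positivity)).1 hrlin)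
  unfold cminus
  rw [le_sub_comm, Real.sqrt_le_iff]
  unfold p1 p2 p3 a1 b1 e1 b2 e2 b3 e3
  refine ⟨sub_nonneg.2 hp1, ?_⟩
  linarith [mul_nonneg hr.le hquad]
end
end

section
/- For every ζ > 0: f_pos(ζ) ≤ (8/15)·ζ⁵ and f_mom(ζ) ≤ (4/3)·ζ³, where f_pos(ζ) = ζ² − 3 + exp(−2ζ)·(3 + 6ζ + 5ζ² + 2ζ³) and f_mom(ζ) = 1 − exp(−2ζ)·(1 + 2ζ + 2ζ²). -/
noncomputable section

open Real

/-- `f_pos(ζ) = ζ² − 3 + exp(−2ζ)(3 + 6ζ + 5ζ² + 2ζ³)`. -/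
def fpos (ζ : ℝ) : ℝ :=
  ζ ^ 2 - 3 + Real.exp (-2 * ζ) * (3 + 6 * ζ + 5 * ζ ^ 2 + 2 * ζ ^ 3)

/-- `f_mom(ζ) = 1 − exp(−2ζ)(1 + 2ζ + 2ζ²)`. -/
def fmom (ζ : ℝ) : ℝ := 1 - Real.exp (-2 * ζ) * (1 + 2 * ζ + 2 * ζ ^ 2)

theorem le_of_hasDerivAt_le_of_nonneg {f g f' g' : ℝ → ℝ} (hf : ∀ x, HasDerivAt f (f' x) x)
    (hg : ∀ x, HasDerivAt g (g' x) x) (h : ∀ x, 0 < x → f' x ≤ g' x) (h₀ : f 0 ≤ g 0)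
    {x : ℝ} (hx : 0 ≤ x) : f x ≤ g x := by
  have hd : ∀ y, HasDerivAt (fun z => g z - f z) (g' y - f' y) y := fun y => (hg y).sub (hf y)
  have hmono : MonotoneOn (fun z => g z - f z) (Set.Ici 0) := by
    refine monotoneOn_of_deriv_nonneg (convex_Ici 0)
      (fun y _ => (hd y).continuousAt.continuousWithinAt)
      (fun y _ => (hd y).differentiableAt.differentiableWithinAt) fun y hy => ?_
    rw [interior_Ici] at hy
    rw [(hd y).deriv]
    exact sub_nonneg.2 (h y hy)
  have := hmono Set.self_mem_Ici hx hx
  dsimp only at this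
  linarith

theorem hasDerivAt_exp_neg_two_mul (x : ℝ) :
    HasDerivAt (fun y => Real.exp (-2 * y)) (-2 * Real.exp (-2 * x)) x := by
  simpa [mul_comm] using ((hasDerivAt_id x).const_mul (-2)).exp

theorem hasDerivAt_const_mul_pow (c : ℝ) (n : ℕ) (x : ℝ) :
    HasDerivAt (fun y => c * y ^ n) (c * (n * x ^ (n - 1))) x :=
  (hasDerivAt_pow n x).const_mul c

theorem hasDerivAt_fmom (x : ℝ) :
    HasDerivAt fmom (4 * x ^ 2 * Real.exp (-2 * x)) x := by
  have hp : HasDerivAt (fun y : ℝ => 1 + 2 * y + 2 * y ^ 2) (2 + 4 * x) x :=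
    ((((hasDerivAt_id' x).const_mul 2).const_add 1).add
      (hasDerivAt_const_mul_pow 2 2 x)).congr_deriv (by push_cast; ring)
  exact (((hasDerivAt_exp_neg_two_mul x).mul hp).const_sub 1).congr_deriv (by ring)

theorem hasDerivAt_fpos (x : ℝ) : HasDerivAt fpos (2 * x * fmom x) x := by
  have hp : HasDerivAt (fun y : ℝ => 3 + 6 * y + 5 * y ^ 2 + 2 * y ^ 3)
      (6 + 10 * x + 6 * x ^ 2) x :=
    (((((hasDerivAt_id' x).const_mul 6).const_add 3).add
      (hasDerivAt_const_mul_pow 5 2 x)).add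
      (hasDerivAt_const_mul_pow 2 3 x)).congr_deriv (by push_cast; ring)
  exact (((hasDerivAt_pow 2 x).sub_const 3).add
    ((hasDerivAt_exp_neg_two_mul x).mul hp)).congr_deriv (by unfold fmom; push_cast; ring)

theorem fmom_le {x : ℝ} (hx : 0 ≤ x) : fmom x ≤ (4/3) * x ^ 3 := by
  refine le_of_hasDerivAt_le_of_nonneg hasDerivAt_fmom (hasDerivAt_const_mul_pow (4/3) 3)
    (fun y hy => ?_) (by simp [fmom]) hx
  have he : Real.exp (-2 * y) ≤ 1 := Real.exp_le_one_iff.2 (by linarith)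
  push_cast
  nlinarith [mul_le_mul_of_nonneg_left he (sq_nonneg y)]

theorem fpos_le {x : ℝ} (hx : 0 ≤ x) : fpos x ≤ (8/15) * x ^ 5 := by
  refine le_of_hasDerivAt_le_of_nonneg hasDerivAt_fpos (hasDerivAt_const_mul_pow (8/15) 5)
    (fun y hy => ?_) (by simp [fpos]) hx
  push_cast
  linarith [mul_le_mul_of_nonneg_left (fmom_le hy.le) hy.le]

/-- Underdamped-regime bounds on the bias functions:
for every `ζ > 0`, `f_pos(ζ) ≤ (8/15)ζ⁵` and `f_mom(ζ) ≤ (4/3)ζ³`. -/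
theorem fpos_fmom_underdamped_bounds (ζ : ℝ) (hζ : 0 < ζ) :
    fpos ζ ≤ (8/15) * ζ ^ 5 ∧ fmom ζ ≤ (4/3) * ζ ^ 3 := by
  exact ⟨fpos_le hζ.le, fmom_le hζ.le⟩
end
end

section
/- For every h, γ, η > 0, d ≥ 1, and κ ≥ 1, setting ζ = hγ: E_pos ≤ (1/√2)·d^{1/2}·κ·η^{1/2}·(h/γ)^{1/2} and E_mom ≤ 4·d^{1/2}·κ·η^{1/2}·h^{−1/2}·γ^{−3/2} (overdamped-regime bounds on the asymptotic-bias terms). -/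
noncomputable section

open Real

/-- `E_pos = sqrt((1/2)·(dκ²η/γ²)·(1/ζ)·f_pos(ζ))` with `ζ = hγ`. -/
def Epos (d : ℕ) (κ η γ h : ℝ) : ℝ :=
  Real.sqrt ((1/2) * ((d : ℝ) * κ ^ 2 * η / γ ^ 2) * (1 / (h * γ)) * fpos (h * γ))

/-- `E_mom = sqrt(4·(dκ²η/γ²)·(1/ζ)·f_mom(ζ))` with `ζ = hγ`. -/
def Emom (d : ℕ) (κ η γ h : ℝ) : ℝ :=
  Real.sqrt (4 * ((d : ℝ) * κ ^ 2 * η / γ ^ 2) * (1 / (h * γ)) * fmom (h * γ))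

/-- The cubic Taylor polynomial of `exp` at `2ζ` dominates the polynomial factor in `fpos`. -/
lemma fpos_le_sq {ζ : ℝ} (hζ : 0 ≤ ζ) : fpos ζ ≤ ζ ^ 2 := by
  have h_taylor := Real.sum_le_exp_of_nonneg (x := 2 * ζ) (by positivity) 4
  norm_num [Finset.sum_range_succ, Nat.factorial] at h_taylor
  have h_poly : 3 + 6 * ζ + 5 * ζ ^ 2 + 2 * ζ ^ 3 ≤ 3 * Real.exp (2 * ζ) := by
    nlinarith [sq_nonneg ζ, pow_nonneg hζ 3]
  have h_mul := mul_le_mul_of_nonneg_left h_poly (Real.exp_pos (-2 * ζ)).le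
  have h_inv : Real.exp (-2 * ζ) * Real.exp (2 * ζ) = 1 := by
    rw [← Real.exp_add]
    simp
  unfold fpos
  linarith

lemma fmom_le_one {ζ : ℝ} (hζ : 0 ≤ ζ) : fmom ζ ≤ 1 := by
  unfold fmom
  have : 0 ≤ Real.exp (-2 * ζ) * (1 + 2 * ζ + 2 * ζ ^ 2) := by positivity
  linarith

/-- Overdamped-regime bounds on the asymptotic-bias terms:
for every `h, γ, η > 0`, `d ≥ 1`, `κ ≥ 1`,
`E_pos ≤ (1/√2)·d^{1/2}·κ·η^{1/2}·(h/γ)^{1/2}` and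
`E_mom ≤ 4·d^{1/2}·κ·η^{1/2}·h^{−1/2}·γ^{−3/2}`. -/
theorem bias_bounds_overdamped (h γ η : ℝ) (hh : 0 < h) (hγ : 0 < γ) (hη : 0 < η)
    (d : ℕ) (hd : 1 ≤ d) (κ : ℝ) (hκ : 1 ≤ κ) :
    Epos d κ η γ h ≤ (1 / Real.sqrt 2) * Real.sqrt d * κ * Real.sqrt η * Real.sqrt (h / γ) ∧
    Emom d κ η γ h ≤ 4 * Real.sqrt d * κ * Real.sqrt η / Real.sqrt (h * γ ^ 3) := by
  have hκ0 : 0 ≤ κ := zero_le_one.trans hκ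
  constructor
  · refine Real.sqrt_le_iff.mpr ⟨by positivity, ?_⟩
    calc (1/2) * ((d : ℝ) * κ ^ 2 * η / γ ^ 2) * (1 / (h * γ)) * fpos (h * γ)
        ≤ (1/2) * ((d : ℝ) * κ ^ 2 * η / γ ^ 2) * (1 / (h * γ)) * (h * γ) ^ 2 := by
          gcongr
          exact fpos_le_sq (by positivity)
      _ = _ := by
          simp only [mul_pow, div_pow]
          rw [Real.sq_sqrt (by positivity), Real.sq_sqrt (by positivity),
            Real.sq_sqrt (by positivity), Real.sq_sqrt (by positivity)]
          field_simp
  · refine Real.sqrt_le_iff.mpr ⟨by positivity, ?_⟩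
    calc 4 * ((d : ℝ) * κ ^ 2 * η / γ ^ 2) * (1 / (h * γ)) * fmom (h * γ)
        ≤ 4 * ((d : ℝ) * κ ^ 2 * η / γ ^ 2) * (1 / (h * γ)) * 1 := by
          gcongr
          exact fmom_le_one (by positivity)
      _ ≤ 16 * ((d : ℝ) * κ ^ 2 * η / γ ^ 2) * (1 / (h * γ)) * 1 := by
          gcongr
          norm_num
      _ = _ := by
          simp only [mul_pow, div_pow]
          rw [Real.sq_sqrt (by positivity), Real.sq_sqrt (by positivity),
            Real.sq_sqrt (by positivity)]
          field_simp
          norm_num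
end
end

section
/- Fix d ≥ 1, κ ≥ 1 and h_LMC > 0, and set η = 1 and h = h_LMC·γ (so ζ = h_LMC·γ²). Then, as γ → ∞, E_pos converges to (1/√2)·d^{1/2}·κ·h_LMC^{1/2} and E_mom converges to 0, where E_pos and E_mom are viewed as functions of γ. -/
noncomputable section

open Real

open Filter

theorem tendsto_pow_mul_exp_neg_two_mul_atTop (n : ℕ) :
    Tendsto (fun x : ℝ => Real.exp (-2 * x) * x ^ n) atTop (nhds 0) := by
  simpa [mul_comm, Real.rpow_natCast] using
    tendsto_rpow_mul_exp_neg_mul_atTop_nhds_zero (n : ℝ) 2 two_pos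

theorem tendsto_inv_sq_atTop : Tendsto (fun x : ℝ => (x ^ 2)⁻¹) atTop (nhds 0) :=
  (tendsto_pow_atTop two_ne_zero).inv_tendsto_atTop

theorem tendsto_fpos_sub_sq :
    Tendsto (fun x : ℝ => fpos x - x ^ 2) atTop (nhds (-3)) := by
  have e := tendsto_pow_mul_exp_neg_two_mul_atTop
  have h := ((((e 0).const_mul 3).add ((e 1).const_mul 6)).add ((e 2).const_mul 5)).add
    ((e 3).const_mul 2) |>.const_add (-3)
  simp only [mul_zero, add_zero] at h
  refine h.congr fun x => ?_
  simp only [fpos]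
  ring

theorem tendsto_fpos_div_sq : Tendsto (fun x : ℝ => fpos x / x ^ 2) atTop (nhds 1) := by
  have h := (tendsto_fpos_sub_sq.mul tendsto_inv_sq_atTop).const_add 1
  simp only [mul_zero, add_zero] at h
  refine h.congr' ?_
  filter_upwards [eventually_gt_atTop 0] with x hx
  field_simp
  ring

theorem tendsto_fmom : Tendsto fmom atTop (nhds 1) := by
  have e := tendsto_pow_mul_exp_neg_two_mul_atTop
  have h := (((e 0).add ((e 1).const_mul 2)).add ((e 2).const_mul 2)).const_sub 1
  simp only [mul_zero, add_zero, sub_zero] at h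
  refine h.congr fun x => ?_
  simp only [fmom]
  ring

theorem tendsto_fmom_div_sq : Tendsto (fun x : ℝ => fmom x / x ^ 2) atTop (nhds 0) := by
  simpa [div_eq_mul_inv] using tendsto_fmom.mul tendsto_inv_sq_atTop

/-- Rescaling the friction `γ` to `ζ = hLMC * γ ^ 2` in a bias term. -/
theorem tendsto_sqrt_bias {f : ℝ → ℝ} {L : ℝ}
    (hf : Tendsto (fun x => f x / x ^ 2) atTop (nhds L)) (c a : ℝ) {hLMC : ℝ} (hpos : 0 < hLMC) :
    Tendsto (fun γ : ℝ => Real.sqrt (c * (a * 1 / γ ^ 2) * (1 / (hLMC * γ * γ)) *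
      f (hLMC * γ * γ))) atTop (nhds (Real.sqrt (c * a * hLMC * L))) := by
  have hζ : Tendsto (fun γ : ℝ => hLMC * γ * γ) atTop atTop :=
    (tendsto_id.const_mul_atTop hpos).atTop_mul_atTop₀ tendsto_id
  refine (((hf.comp hζ).const_mul (c * a * hLMC)).sqrt).congr' ?_
  filter_upwards [eventually_gt_atTop 0] with γ hγ
  congr 1
  simp only [Function.comp_apply]
  field_simp

/-- Overdamped limit of the asymptotic-bias terms:
with `η = 1` and the time-accelerated step size `h = h_LMC·γ` (so `ζ = h_LMC·γ²`),
as `γ → ∞`, `E_pos → (1/√2)·d^{1/2}·κ·h_LMC^{1/2}` and `E_mom → 0`. -/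
theorem bias_overdamped_limit (d : ℕ) (hd : 1 ≤ d) (κ : ℝ) (hκ : 1 ≤ κ)
    (hLMC : ℝ) (hpos : 0 < hLMC) :
    Tendsto (fun γ : ℝ => Epos d κ 1 γ (hLMC * γ)) atTop
      (nhds ((1 / Real.sqrt 2) * Real.sqrt d * κ * Real.sqrt hLMC)) ∧
    Tendsto (fun γ : ℝ => Emom d κ 1 γ (hLMC * γ)) atTop (nhds 0) := by
  refine ⟨?_, ?_⟩
  · have hκ0 : 0 ≤ κ := zero_le_one.trans hκ
    have hlim : Real.sqrt (1 / 2 * ((d : ℝ) * κ ^ 2) * hLMC * 1) =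
        (1 / Real.sqrt 2) * Real.sqrt d * κ * Real.sqrt hLMC := by
      rw [mul_one, Real.sqrt_mul (by positivity), Real.sqrt_mul (by positivity),
        Real.sqrt_mul (by positivity), Real.sqrt_sq hκ0, Real.sqrt_div zero_le_one, Real.sqrt_one]
      ring
    rw [← hlim]
    exact tendsto_sqrt_bias tendsto_fpos_div_sq (1 / 2) ((d : ℝ) * κ ^ 2) hpos
  · simpa only [Emom, mul_zero, Real.sqrt_zero] using
      tendsto_sqrt_bias tendsto_fmom_div_sq 4 ((d : ℝ) * κ ^ 2) hpos
end
end
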